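/- (Koopman decomposition of the Burgers flow.) Let u₀ ∈ Ω_B, t > 0 and x ∈ [0,1]. Then the family (e^{λ_ν t} φ_ν(u₀) a_ν(x))_{ν ∈ 𝒜} is absolutely summable and Σ_{ν ∈ 𝒜} e^{λ_ν t} φ_ν(u₀) a_ν(x) = u(t,x), where u(t,x) = −2 ∂ₓv(t,x)/v(t,x) is the Burgers evolution of u₀. -/

import Mathlib

open MeasureTheory Real Set

/-- The `L²([0,1])` norm of a real function. -/
noncomputable def L2norm (f : ℝ → ℝ) : ℝ := Real.sqrt (∫ s in (0:ℝ)..1, f s ^ 2)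

/-- The Cole-Hopf transform `H`. -/
noncomputable def coleHopfH (u : ℝ → ℝ) : ℝ → ℝ := fun x =>
  Real.exp (-(1/2) * ∫ s in (0:ℝ)..x, u s) /
    ∫ y in (0:ℝ)..1, Real.exp (-(1/2) * ∫ s in (0:ℝ)..y, u s)

/-- The cosine Fourier coefficient `cₙ(v) = √2 ∫₀¹ v(s) cos(nπs) ds`. -/
noncomputable def cCoef (n : ℕ) (v : ℝ → ℝ) : ℝ :=
  Real.sqrt 2 * ∫ s in (0:ℝ)..1, v s * Real.cos (n * π * s)

/-- `lₙ(u) = cₙ(H(u))`. -/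
noncomputable def lCoef (n : ℕ) (u : ℝ → ℝ) : ℝ := cCoef n (coleHopfH u)

/-- `u₀ ∈ Ω_B` : `u₀ ∈ L²([0,1])` with `2 e^{‖u₀‖} ‖u₀‖ < 1`. -/
def MemOmegaB (u₀ : ℝ → ℝ) : Prop :=
  IntervalIntegrable u₀ volume 0 1 ∧ IntervalIntegrable (fun s => u₀ s ^ 2) volume 0 1 ∧
    2 * Real.exp (L2norm u₀) * L2norm u₀ < 1

/-- The heat evolution `v(t,x) = 1 + Σ_{n≥1} e^{-n²π²t} lₙ(u₀) √2 cos(nπx)`. -/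
noncomputable def heatV (u₀ : ℝ → ℝ) (t x : ℝ) : ℝ :=
  1 + ∑' n : ℕ+, Real.exp (-((n : ℕ) : ℝ) ^ 2 * π ^ 2 * t) * lCoef (n : ℕ) u₀ *
    (Real.sqrt 2 * Real.cos (((n : ℕ) : ℝ) * π * x))

/-- The spatial derivative of the heat evolution,
`∂ₓv(t,x) = -Σ_{n≥1} e^{-n²π²t} lₙ(u₀) √2 nπ sin(nπx)`. -/
noncomputable def heatVx (u₀ : ℝ → ℝ) (t x : ℝ) : ℝ :=
  -∑' n : ℕ+, Real.exp (-((n : ℕ) : ℝ) ^ 2 * π ^ 2 * t) * lCoef (n : ℕ) u₀ *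
    (Real.sqrt 2 * ((n : ℕ) : ℝ) * π * Real.sin (((n : ℕ) : ℝ) * π * x))

/-- The Burgers evolution `u(t,x) = -2 ∂ₓv(t,x) / v(t,x)`. -/
noncomputable def burgersU (u₀ : ℝ → ℝ) (t x : ℝ) : ℝ := -2 * heatVx u₀ t x / heatV u₀ t x

/-- The Koopman index set `𝒜`: a tuple `ν = (n₀, n₁, …, n_{α(ν)})` of positive integers,
encoded as the head `n₀ : ℕ+` together with the (possibly empty) list `(n₁, …, n_{α(ν)})`. -/
abbrev KoopIdx : Type := ℕ+ × List ℕ+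

/-- The Koopman eigenvalue `λ_ν = -π² Σ_{k=0}^{α(ν)} n_k²`. -/
noncomputable def lamIdx (ν : KoopIdx) : ℝ :=
  -π ^ 2 * ((((ν.1 : ℕ) : ℝ)) ^ 2 + (ν.2.map (fun k => (((k : ℕ) : ℝ)) ^ 2)).sum)

/-- The Koopman mode
`a_ν(x) = (-1)^{α(ν)} 2^{(α(ν)+3)/2} n₀ π sin(n₀πx) ∏_{k=1}^{α(ν)} cos(n_kπx)`. -/
noncomputable def aIdx (ν : KoopIdx) (x : ℝ) : ℝ :=
  (-1 : ℝ) ^ ν.2.length * (2 : ℝ) ^ (((ν.2.length : ℝ) + 3) / 2) * ((ν.1 : ℕ) : ℝ) * π *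
    Real.sin (((ν.1 : ℕ) : ℝ) * π * x) *
    (ν.2.map (fun k => Real.cos (((k : ℕ) : ℝ) * π * x))).prod

/-- The Koopman eigenfunctional `φ_ν(u₀) = ∏_{k=0}^{α(ν)} l_{n_k}(u₀)`. -/
noncomputable def phiIdx (u₀ : ℝ → ℝ) (ν : KoopIdx) : ℝ :=
  lCoef (ν.1 : ℕ) u₀ * (ν.2.map (fun k => lCoef (k : ℕ) u₀)).prod

theorem kd_list_summable {α : Type*} (g : α → ℝ) (hg : Summable (fun a => |g a|))
    (hs : ∑' a, |g a| < 1) : Summable (fun l : List α => |(l.map g).prod|) := by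
  have hs0 : 0 ≤ ∑' a, |g a| := tsum_nonneg (fun _ => abs_nonneg _)
  set s := ∑' a, |g a| with hsdef
  -- bound on finite sums over lists of bounded length
  have key : ∀ n : ℕ, ∀ F : Finset (List α), (∀ l ∈ F, l.length < n) →
      ∑ l ∈ F, |(l.map g).prod| ≤ 1 / (1 - s) := by
    classical
    intro n
    induction n with
    | zero =>
      intro F hF
      have : F = ∅ := Finset.eq_empty_of_forall_notMem (fun l hl => by simpa using hF l hl)
      subst this
      simp only [Finset.sum_empty]
      exact div_nonneg zero_le_one (by linarith)
    | succ n ih =>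
      intro F hF
      let A : Finset α := F.biUnion (fun l => l.toFinset)
      let T : Finset (List α) := F.image List.tail
      let T' := T.filter (fun l => l.length < n)
      have hsub : F ⊆ insert [] ((A ×ˢ T').image (fun p => p.1 :: p.2)) := by
        intro l hl
        cases l with
        | nil => simp
        | cons a l =>
          apply Finset.mem_insert_of_mem
          refine Finset.mem_image.2 ⟨(a, l), ?_, rfl⟩
          refine Finset.mem_product.2 ⟨?_, ?_⟩
          · exact Finset.mem_biUnion.2 ⟨a :: l, hl, by simp⟩
          · refine Finset.mem_filter.2 ⟨Finset.mem_image.2 ⟨a :: l, hl, rfl⟩, ?_⟩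
            have := hF _ hl
            simpa using this
      calc ∑ l ∈ F, |(l.map g).prod|
          ≤ ∑ l ∈ insert [] ((A ×ˢ T').image (fun p => p.1 :: p.2)), |(l.map g).prod| :=
            Finset.sum_le_sum_of_subset_of_nonneg hsub (fun _ _ _ => abs_nonneg _)
        _ = 1 + (∑ a ∈ A, |g a|) * ∑ l ∈ T', |(l.map g).prod| := by
            rw [Finset.sum_insert (by simp), Finset.sum_image (by
              rintro ⟨a, b⟩ _ ⟨c, d⟩ _ h
              simpa using h), Finset.sum_product, Finset.sum_mul_sum]
            simp [abs_mul]
        _ ≤ 1 + s * (1 / (1 - s)) := by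
            have h1 : ∑ a ∈ A, |g a| ≤ s := hg.sum_le_tsum _ (fun _ _ => abs_nonneg _)
            have h2 := ih T' (fun l hl => (Finset.mem_filter.1 hl).2)
            have h3 : 0 ≤ ∑ l ∈ T', |(l.map g).prod| :=
              Finset.sum_nonneg (fun _ _ => abs_nonneg _)
            gcongr
        _ = 1 / (1 - s) := by
            have : (1 - s) ≠ 0 := by linarith
            field_simp
            ring
  refine summable_of_sum_le (c := 1 / (1 - s)) (fun _ => abs_nonneg _) (fun F => ?_)
  refine key (F.sup List.length + 1) F (fun l hl => ?_)
  exact Nat.lt_succ_of_le (Finset.le_sup (f := List.length) hl)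

def kdListEquiv (α : Type*) : Unit ⊕ (α × List α) ≃ List α where
  toFun
    | Sum.inl _ => []
    | Sum.inr p => p.1 :: p.2
  invFun
    | [] => Sum.inl ()
    | a :: l => Sum.inr (a, l)
  left_inv o := by cases o <;> rfl
  right_inv l := by cases l <;> rfl

theorem kd_list_tsum {α : Type*} (g : α → ℝ) (hg : Summable (fun a => |g a|))
    (hs : ∑' a, |g a| < 1) : (∑' l : List α, (l.map g).prod) = 1 / (1 - ∑' a, g a) := by
  have hL := kd_list_summable g hg hs
  have hL' : Summable (fun l : List α => (l.map g).prod) := hL.of_abs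
  have hg' : Summable g := hg.of_abs
  have hlt : ∑' a, g a < 1 := by
    refine lt_of_le_of_lt ?_ hs
    exact hg'.tsum_le_tsum (fun a => le_abs_self _) hg
  have e1 : (∑' l : List α, (l.map g).prod)
      = 1 + (∑' a, g a) * ∑' l : List α, (l.map g).prod := by
    have hgn : Summable (fun a => ‖g a‖) := by simpa only [Real.norm_eq_abs] using hg
    have hLn : Summable (fun l : List α => ‖(l.map g).prod‖) := by
      simpa only [Real.norm_eq_abs] using hL
    rw [tsum_mul_tsum_of_summable_norm hgn hLn]
    have hP := (summable_mul_of_summable_norm hgn hLn).hasSum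
    have hH : HasSum (fun o : Unit ⊕ (α × List α) => ((kdListEquiv α o).map g).prod)
        (1 + ∑' p : α × List α, g p.1 * (p.2.map g).prod) := by
      refine HasSum.sum ?_ ?_
      · have := hasSum_unique (fun _ : Unit => (1:ℝ))
        simpa [kdListEquiv, Function.comp_def] using this
      · simpa [kdListEquiv, Function.comp_def] using hP
    rw [← hH.tsum_eq]
    exact ((kdListEquiv α).tsum_eq (fun l : List α => (l.map g).prod)).symm
  rw [eq_div_iff (by linarith)]
  linarith

theorem kd_int_cos (k : ℤ) :
    ∫ s in (0:ℝ)..1, Real.cos ((k : ℝ) * π * s) = if k = 0 then 1 else 0 := by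
  split_ifs with hk
  · simp [hk]
  · have hc : (k : ℝ) * π ≠ 0 := mul_ne_zero (by exact_mod_cast hk) Real.pi_ne_zero
    rw [intervalIntegral.integral_comp_mul_left (fun y => Real.cos y) hc]
    simp [Real.sin_int_mul_pi]

theorem kd_orth (m n : ℕ+) :
    ∫ s in (0:ℝ)..1, Real.sin ((m : ℕ) * π * s) * Real.sin ((n : ℕ) * π * s)
      = if m = n then 1 / 2 else 0 := by
  have e : ∀ s : ℝ, Real.sin ((m : ℕ) * π * s) * Real.sin ((n : ℕ) * π * s)
      = 1 / 2 * Real.cos ((((m : ℕ) : ℤ) - ((n : ℕ) : ℤ) : ℤ) * π * s)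
        - 1 / 2 * Real.cos ((((m : ℕ) : ℤ) + ((n : ℕ) : ℤ) : ℤ) * π * s) := by
    intro s
    push_cast
    rw [add_mul, add_mul, sub_mul, sub_mul, Real.cos_add, Real.cos_sub]
    ring
  simp_rw [e]
  rw [intervalIntegral.integral_sub (Continuous.intervalIntegrable (by fun_prop) _ _)
    (Continuous.intervalIntegrable (by fun_prop) _ _),
    intervalIntegral.integral_const_mul, intervalIntegral.integral_const_mul,
    kd_int_cos, kd_int_cos]
  have hm := m.pos
  have hn := n.pos
  have h2 : ¬ (((m : ℕ) : ℤ) + ((n : ℕ) : ℤ) = 0) := by omega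
  rw [if_neg h2]
  by_cases h : m = n
  · subst h; simp
  · have : ¬ (((m : ℕ) : ℤ) - ((n : ℕ) : ℤ) = 0) := by
      intro h'
      apply h
      apply PNat.eq
      omega
    rw [if_neg this, if_neg h]; simp

theorem kd_bessel (g : ℝ → ℝ) (hg : IntervalIntegrable g volume 0 1)
    (hg2 : IntervalIntegrable (fun s => g s ^ 2) volume 0 1) (F : Finset ℕ+) :
    2 * ∑ n ∈ F, (∫ s in (0:ℝ)..1, g s * Real.sin ((n : ℕ) * π * s)) ^ 2
      ≤ ∫ s in (0:ℝ)..1, g s ^ 2 := by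
  set b : ℕ+ → ℝ := fun n => ∫ s in (0:ℝ)..1, g s * Real.sin ((n : ℕ) * π * s) with hb
  set P : ℝ → ℝ := fun s => ∑ n ∈ F, 2 * b n * Real.sin ((n : ℕ) * π * s) with hP
  have hPc : Continuous P := by rw [hP]; fun_prop
  have igP : IntervalIntegrable (fun s => g s * P s) volume 0 1 :=
    hg.mul_continuousOn hPc.continuousOn
  have iP2 : IntervalIntegrable (fun s => P s ^ 2) volume 0 1 :=
    (hPc.pow 2).intervalIntegrable _ _
  have h0 : 0 ≤ ∫ s in (0:ℝ)..1, (g s - P s) ^ 2 :=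
    intervalIntegral.integral_nonneg zero_le_one (fun _ _ => sq_nonneg _)
  have e : ∀ s, (g s - P s) ^ 2 = g s ^ 2 - 2 * (g s * P s) + P s ^ 2 := fun s => by ring
  simp_rw [e] at h0
  rw [intervalIntegral.integral_add (hg2.sub (igP.const_mul 2)) iP2,
    intervalIntegral.integral_sub hg2 (igP.const_mul 2),
    intervalIntegral.integral_const_mul] at h0
  have e1 : ∫ s in (0:ℝ)..1, g s * P s = ∑ n ∈ F, 2 * b n ^ 2 := by
    simp only [hP, Finset.mul_sum]
    rw [intervalIntegral.integral_finsetSum]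
    · refine Finset.sum_congr rfl (fun n _ => ?_)
      have : ∀ s, g s * (2 * b n * Real.sin ((n : ℕ) * π * s))
        = 2 * b n * (g s * Real.sin ((n : ℕ) * π * s)) := fun s => by ring
      simp_rw [this]
      rw [intervalIntegral.integral_const_mul]
      simp only [hb]; ring
    · intro n _
      exact hg.mul_continuousOn (Continuous.continuousOn (by fun_prop))
  have e2 : ∫ s in (0:ℝ)..1, P s ^ 2 = ∑ n ∈ F, 2 * b n ^ 2 := by
    simp only [hP, pow_two, Finset.sum_mul_sum]
    rw [intervalIntegral.integral_finsetSum]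
    · refine Finset.sum_congr rfl (fun n hn => ?_)
      rw [intervalIntegral.integral_finsetSum]
      · have : ∀ m : ℕ+, ∫ s in (0:ℝ)..1, 2 * b n * Real.sin ((n : ℕ) * π * s) *
            (2 * b m * Real.sin ((m : ℕ) * π * s)) = if n = m then 2 * (b n * b n) else 0 := by
          intro m
          have e3 : ∀ s : ℝ, 2 * b n * Real.sin ((n : ℕ) * π * s) *
            (2 * b m * Real.sin ((m : ℕ) * π * s)) =
            4 * b n * b m * (Real.sin ((n : ℕ) * π * s) * Real.sin ((m : ℕ) * π * s)) :=
            fun s => by ring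
          simp_rw [e3]
          rw [intervalIntegral.integral_const_mul, kd_orth]
          split_ifs with h
          · subst h; ring
          · simp
        simp_rw [this]
        simp [hn]
      · intro m _
        exact Continuous.intervalIntegrable (by fun_prop) _ _
    · intro n _
      exact Continuous.intervalIntegrable (by fun_prop) _ _
  rw [e1, e2] at h0
  rw [Finset.mul_sum]
  linarith

theorem kd_abs_int (u : ℝ → ℝ) (hu : IntervalIntegrable u volume 0 1)
    (hu2 : IntervalIntegrable (fun s => u s ^ 2) volume 0 1) {x : ℝ} (hx : x ∈ Icc (0:ℝ) 1) :
    |∫ s in (0:ℝ)..x, u s| ≤ L2norm u := by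
  have h1 : |∫ s in (0:ℝ)..x, u s| ≤ ∫ s in (0:ℝ)..1, |u s| := by
    refine (intervalIntegral.abs_integral_le_integral_abs hx.1).trans ?_
    refine intervalIntegral.integral_mono_interval le_rfl hx.1 hx.2 ?_ hu.abs
    exact Filter.Eventually.of_forall (fun _ => abs_nonneg _)
  refine h1.trans ?_
  set c := ∫ s in (0:ℝ)..1, |u s| with hc
  apply Real.le_sqrt_of_sq_le
  have h0 : 0 ≤ ∫ s in (0:ℝ)..1, (|u s| - c) ^ 2 :=
    intervalIntegral.integral_nonneg zero_le_one (fun _ _ => sq_nonneg _)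
  have e : ∀ s, (|u s| - c) ^ 2 = u s ^ 2 - 2 * c * |u s| + c ^ 2 := fun s => by
    rw [← sq_abs (u s)]; ring
  simp_rw [e] at h0
  rw [intervalIntegral.integral_add (hu2.sub (hu.abs.const_mul (2 * c))) (by simp),
    intervalIntegral.integral_sub hu2 (hu.abs.const_mul (2 * c)),
    intervalIntegral.integral_const_mul, ← hc] at h0
  simp at h0
  linarith

theorem kd_ac_exp {f : ℝ → ℝ} (hf : AbsolutelyContinuousOnInterval f 0 1) :
    AbsolutelyContinuousOnInterval (fun x => Real.exp (f x)) 0 1 := by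
  obtain ⟨C, hC⟩ := hf.exists_bound
  have hC' : ∀ x ∈ uIcc (0:ℝ) 1, f x ∈ Icc (-C) C := fun x hx => by
    have := hC x hx
    rw [Real.norm_eq_abs] at this
    exact abs_le.1 this
  obtain ⟨K, hK⟩ := (Real.contDiff_exp (n := 1)).contDiffOn.exists_lipschitzOnWith (by decide)
    (convex_Icc (-C) C) isCompact_Icc
  rw [absolutelyContinuousOnInterval_iff] at hf ⊢
  intro ε hε
  obtain ⟨δ, hδ, h⟩ := hf (ε / (K + 1)) (by positivity)
  refine ⟨δ, hδ, fun E hE hlt => ?_⟩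
  have h2 := h E hE hlt
  calc _ ≤ ∑ i ∈ Finset.range E.1, K * dist (f (E.2 i).1) (f (E.2 i).2) := by
        refine Finset.sum_le_sum (fun i hi => ?_)
        exact hK.dist_le_mul _ (hC' _ (hE.1 i hi).1) _ (hC' _ (hE.1 i hi).2)
    _ = K * ∑ i ∈ Finset.range E.1, dist (f (E.2 i).1) (f (E.2 i).2) := (Finset.mul_sum _ _ _).symm
    _ ≤ K * (ε / (K + 1)) := by gcongr
    _ < (K + 1) * (ε / (K + 1)) := by gcongr; linarith
    _ = ε := by field

theorem kd_H_ac (u : ℝ → ℝ) (hu : IntervalIntegrable u volume 0 1) :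
    AbsolutelyContinuousOnInterval (coleHopfH u) 0 1 := by
  have hI := hu.absolutelyContinuousOnInterval_intervalIntegral (c := 0) (by simp)
  have hE := kd_ac_exp (hI.const_mul (-(1/2)))
  have := hE.const_mul ((∫ y in (0:ℝ)..1, Real.exp (-(1/2) * ∫ s in (0:ℝ)..y, u s))⁻¹)
  refine (congrArg (fun f => AbsolutelyContinuousOnInterval f 0 1) ?_).mp this
  funext x
  exact (div_eq_inv_mul _ _).symm

/-- Integration by parts against the cosine. -/
theorem kd_parts (u : ℝ → ℝ) (hu : IntervalIntegrable u volume 0 1) (n : ℕ+) :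
    Real.sqrt 2 * lCoef (n : ℕ) u * ((n : ℕ) * π)
      = ∫ s in (0:ℝ)..1, (u s * coleHopfH u s) * Real.sin ((n : ℕ) * π * s) := by
  set Z := ∫ y in (0:ℝ)..1, Real.exp (-(1/2) * ∫ s in (0:ℝ)..y, u s) with hZ
  have hH := kd_H_ac u hu
  have hS : AbsolutelyContinuousOnInterval (fun s : ℝ => Real.sin ((n : ℕ) * π * s)) 0 1 := by
    apply ContDiffOn.absolutelyContinuousOnInterval
    apply ContDiff.contDiffOn
    fun_prop
  have hp := hH.integral_mul_deriv_eq_deriv_mul hS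
  have hd : ∀ s : ℝ, deriv (fun s : ℝ => Real.sin ((n : ℕ) * π * s)) s
      = (n : ℕ) * π * Real.cos ((n : ℕ) * π * s) := by
    intro s
    have : HasDerivAt (fun s : ℝ => Real.sin ((n : ℕ) * π * s))
      (Real.cos ((n : ℕ) * π * s) * ((n : ℕ) * π * 1)) s :=
      ((hasDerivAt_id s).const_mul (((n : ℕ) : ℝ) * π)).sin
    rw [this.deriv]; ring
  have hd2 : ∫ s in (0:ℝ)..1, deriv (coleHopfH u) s * Real.sin ((n : ℕ) * π * s)
      = ∫ s in (0:ℝ)..1, -(1/2) * ((u s * coleHopfH u s) * Real.sin ((n : ℕ) * π * s)) := by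
    apply intervalIntegral.integral_congr_ae
    filter_upwards [hu.ae_hasDerivAt_integral] with x hx hx'
    have h1 := hx (uIoc_subset_uIcc hx') 0 (by simp)
    have h2 : HasDerivAt (coleHopfH u)
      (Real.exp (-(1/2) * ∫ s in (0:ℝ)..x, u s) * (-(1/2) * u x) / Z) x :=
      ((h1.const_mul (-(1/2))).exp).div_const Z
    rw [h2.deriv]
    simp only [coleHopfH, ← hZ]
    ring
  rw [hd2, intervalIntegral.integral_const_mul] at hp
  simp_rw [hd] at hp
  have e : ∀ s : ℝ, coleHopfH u s * ((n : ℕ) * π * Real.cos ((n : ℕ) * π * s))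
    = ((n : ℕ) * π) * (coleHopfH u s * Real.cos ((n : ℕ) * π * s)) := fun s => by ring
  simp_rw [e] at hp
  rw [intervalIntegral.integral_const_mul] at hp
  simp only [mul_one, mul_zero, Real.sin_zero, Real.sin_nat_mul_pi] at hp
  have h2 : Real.sqrt 2 * Real.sqrt 2 = 2 := Real.mul_self_sqrt (by norm_num)
  simp only [lCoef, cCoef]
  linear_combination 2 * hp + ((n : ℕ) * π) *
    (∫ s in (0:ℝ)..1, coleHopfH u s * Real.cos ((n : ℕ) * π * s)) * h2

theorem kd_H_bound (u : ℝ → ℝ) (hu : IntervalIntegrable u volume 0 1)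
    (hu2 : IntervalIntegrable (fun s => u s ^ 2) volume 0 1) {x : ℝ} (hx : x ∈ Icc (0:ℝ) 1) :
    0 ≤ coleHopfH u x ∧ coleHopfH u x ≤ Real.exp (L2norm u) := by
  set M := L2norm u with hM
  have hb : ∀ y ∈ Icc (0:ℝ) 1, Real.exp (-(M/2)) ≤ Real.exp (-(1/2) * ∫ s in (0:ℝ)..y, u s) ∧
      Real.exp (-(1/2) * ∫ s in (0:ℝ)..y, u s) ≤ Real.exp (M/2) := by
    intro y hy
    have := abs_le.1 (kd_abs_int u hu hu2 hy)
    constructor <;> apply Real.exp_le_exp.2 <;> linarith [this.1, this.2]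
  have hI := hu.absolutelyContinuousOnInterval_intervalIntegral (c := 0) (by simp)
  have hE := kd_ac_exp (hI.const_mul (-(1/2)))
  have hZ : Real.exp (-(M/2)) ≤ ∫ y in (0:ℝ)..1, Real.exp (-(1/2) * ∫ s in (0:ℝ)..y, u s) := by
    have h1 : ∫ y in (0:ℝ)..1, Real.exp (-(M/2)) = Real.exp (-(M/2)) := by simp
    rw [← h1]
    exact intervalIntegral.integral_mono_on zero_le_one (by simp)
      hE.continuousOn.intervalIntegrable (fun y hy => (hb y hy).1)
  have hZ0 := lt_of_lt_of_le (Real.exp_pos _) hZ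
  refine ⟨div_nonneg (Real.exp_pos _).le hZ0.le, ?_⟩
  unfold coleHopfH
  rw [div_le_iff₀ hZ0]
  calc _ ≤ Real.exp (M/2) := (hb x hx).2
    _ = Real.exp M * Real.exp (-(M/2)) := by rw [← Real.exp_add]; congr 1; ring
    _ ≤ _ := by gcongr

theorem kd_coef (u : ℝ → ℝ) (h : MemOmegaB u) :
    (∀ n : ℕ+, |Real.sqrt 2 * lCoef (n : ℕ) u * ((n : ℕ) * π)| ≤ 1) ∧
    Summable (fun n : ℕ+ => |Real.sqrt 2 * lCoef (n : ℕ) u|) ∧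
    ∑' n : ℕ+, |Real.sqrt 2 * lCoef (n : ℕ) u| < 1 := by
  obtain ⟨hu, hu2, hM⟩ := h
  have hHc := (kd_H_ac u hu).continuousOn
  have hg : IntervalIntegrable (fun s => u s * coleHopfH u s) volume 0 1 :=
    hu.mul_continuousOn hHc
  have hg2 : IntervalIntegrable (fun s => (u s * coleHopfH u s) ^ 2) volume 0 1 := by
    simp_rw [mul_pow]
    exact hu2.mul_continuousOn (hHc.pow 2)
  have hM0 : 0 ≤ L2norm u := Real.sqrt_nonneg _
  have hMsq : L2norm u ^ 2 = ∫ s in (0:ℝ)..1, u s ^ 2 :=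
    Real.sq_sqrt (intervalIntegral.integral_nonneg zero_le_one (fun _ _ => sq_nonneg _))
  have hG : ∫ s in (0:ℝ)..1, (u s * coleHopfH u s) ^ 2 ≤ 1 / 4 := by
    calc _ ≤ ∫ s in (0:ℝ)..1, Real.exp (L2norm u) ^ 2 * u s ^ 2 := by
          refine intervalIntegral.integral_mono_on zero_le_one hg2 (hu2.const_mul _) ?_
          intro x hx
          obtain ⟨h1, h2⟩ := kd_H_bound u hu hu2 hx
          rw [mul_pow, mul_comm]
          gcongr
      _ = (Real.exp (L2norm u) * L2norm u) ^ 2 := by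
          rw [intervalIntegral.integral_const_mul, ← hMsq, mul_pow]
      _ ≤ (1 / 2) ^ 2 := by
          have : 0 ≤ Real.exp (L2norm u) * L2norm u := by positivity
          gcongr
          linarith
      _ = 1 / 4 := by norm_num
  set b : ℕ+ → ℝ := fun n => Real.sqrt 2 * lCoef (n : ℕ) u * ((n : ℕ) * π) with hbdef
  have hbes : ∀ F : Finset ℕ+, ∑ n ∈ F, b n ^ 2 ≤ 1 / 8 := by
    intro F
    have := kd_bessel _ hg hg2 F
    simp_rw [← kd_parts u hu] at this
    simp only [hbdef]
    linarith
  have hz : ∀ F : Finset ℕ+, ∑ n ∈ F, 1 / (((n : ℕ) : ℝ)) ^ 2 ≤ π ^ 2 / 6 := by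
    intro F
    have h1 := hasSum_zeta_two
    have h2 := sum_le_hasSum (F.map ⟨fun n : ℕ+ => (n : ℕ), PNat.coe_injective⟩)
      (fun i _ => by positivity) h1
    simpa using h2
  have hpt : ∀ n : ℕ+, |Real.sqrt 2 * lCoef (n : ℕ) u|
      ≤ 1 / 2 * b n ^ 2 + 1 / (2 * π ^ 2) * (1 / (((n : ℕ) : ℝ)) ^ 2) := by
    intro n
    have hn : (0:ℝ) < (n : ℕ) := by exact_mod_cast n.pos
    have hnp : (0:ℝ) < (n : ℕ) * π := by positivity
    have e : Real.sqrt 2 * lCoef (n : ℕ) u = b n * (1 / ((n : ℕ) * π)) := by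
      simp only [hbdef]; field_simp
    rw [e, abs_mul, abs_of_pos (a := 1 / (((n : ℕ) : ℝ) * π)) (by positivity)]
    have h2 : 1 / (2 * π ^ 2) * (1 / (((n : ℕ) : ℝ)) ^ 2) = 1 / 2 * (1 / ((n : ℕ) * π)) ^ 2 := by
      field_simp
    rw [h2, ← sq_abs (b n)]
    nlinarith [sq_nonneg (|b n| - 1 / ((n : ℕ) * π))]
  have hsum : ∀ F : Finset ℕ+, ∑ n ∈ F, |Real.sqrt 2 * lCoef (n : ℕ) u| ≤ 1 / 2 := by
    intro F
    calc _ ≤ ∑ n ∈ F, (1 / 2 * b n ^ 2 + 1 / (2 * π ^ 2) * (1 / (((n : ℕ) : ℝ)) ^ 2)) :=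
          Finset.sum_le_sum (fun n _ => hpt n)
      _ = 1 / 2 * ∑ n ∈ F, b n ^ 2 + 1 / (2 * π ^ 2) * ∑ n ∈ F, 1 / (((n : ℕ) : ℝ)) ^ 2 := by
          rw [Finset.sum_add_distrib, Finset.mul_sum, Finset.mul_sum]
      _ ≤ 1 / 2 * (1 / 8) + 1 / (2 * π ^ 2) * (π ^ 2 / 6) := by
          gcongr
          · exact hbes F
          · exact hz F
      _ ≤ 1 / 2 := by
          have : 1 / (2 * π ^ 2) * (π ^ 2 / 6) = 1 / 12 := by
            have := Real.pi_ne_zero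
            field_simp
            norm_num
          rw [this]; norm_num
  have hS : Summable (fun n : ℕ+ => |Real.sqrt 2 * lCoef (n : ℕ) u|) :=
    summable_of_sum_le (fun _ => abs_nonneg _) hsum
  refine ⟨fun n => ?_, hS, lt_of_le_of_lt (hS.tsum_le_of_sum_le hsum) (by norm_num)⟩
  have := hbes {n}
  rw [Finset.sum_singleton] at this
  rw [← sq_le_one_iff_abs_le_one]
  linarith

theorem kd_coe_list (l : List ℕ+) :
    (do let a ← l; pure (a : ℕ)) = l.map (fun a : ℕ+ => (a : ℕ)) := by
  induction l with
  | nil => rfl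
  | cons a l ih => exact congrArg (List.cons (a : ℕ)) ih

theorem kd_term (u₀ : ℝ → ℝ) (t x : ℝ) (m : ℕ+) (l : List ℕ+) :
    Real.exp (lamIdx (m, l) * t) * phiIdx u₀ (m, l) * aIdx (m, l) x
      = (2 * (Real.exp (-((m : ℕ) : ℝ) ^ 2 * π ^ 2 * t) * lCoef (m : ℕ) u₀ *
          (Real.sqrt 2 * ((m : ℕ) : ℝ) * π * Real.sin (((m : ℕ) : ℝ) * π * x)))) *
        (l.map (fun n : ℕ+ => -(Real.exp (-((n : ℕ) : ℝ) ^ 2 * π ^ 2 * t) * lCoef (n : ℕ) u₀ *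
          (Real.sqrt 2 * Real.cos (((n : ℕ) : ℝ) * π * x))))).prod := by
  induction l with
  | nil =>
    have h3 : (2:ℝ) ^ ((3:ℝ) / 2) = 2 * Real.sqrt 2 := by
      rw [Real.sqrt_eq_rpow, show (3:ℝ)/2 = 1 + 1/2 by norm_num,
        Real.rpow_add (by norm_num), Real.rpow_one]
    simp only [lamIdx, phiIdx, aIdx, kd_coe_list, List.map_nil, List.sum_nil, List.prod_nil, List.length_nil,
      Nat.cast_zero, zero_add, pow_zero, h3, add_zero]
    rw [show -π ^ 2 * ((m : ℕ) : ℝ) ^ 2 * t = -((m : ℕ) : ℝ) ^ 2 * π ^ 2 * t by ring]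
    ring
  | cons k l ih =>
    rw [List.map_cons, List.prod_cons, mul_left_comm, ← ih]
    simp only [lamIdx, phiIdx, aIdx, kd_coe_list, List.map_cons, List.sum_cons, List.prod_cons,
      List.length_cons]
    have h3 : (2:ℝ) ^ ((((l.length + 1 : ℕ) : ℝ) + 3) / 2)
        = (2:ℝ) ^ (((l.length : ℝ) + 3) / 2) * Real.sqrt 2 := by
      rw [Real.sqrt_eq_rpow, ← Real.rpow_add (by norm_num)]
      congr 1
      push_cast
      ring
    rw [h3, show -π ^ 2 * (((m : ℕ) : ℝ) ^ 2 + (((k : ℕ) : ℝ) ^ 2 +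
        (List.map (fun k : ℕ => ((k : ℝ)) ^ 2) (l.map (fun a : ℕ+ => (a : ℕ)))).sum)) * t
      = -((k : ℕ) : ℝ) ^ 2 * π ^ 2 * t + -π ^ 2 * (((m : ℕ) : ℝ) ^ 2 +
        (List.map (fun k : ℕ => ((k : ℝ)) ^ 2) (l.map (fun a : ℕ+ => (a : ℕ)))).sum) * t by ring, Real.exp_add, pow_succ]
    ring

/-- **Koopman decomposition of the Burgers flow.** For `u₀ ∈ Ω_B`, `t > 0` and
`x ∈ [0,1]`, the family `(e^{λ_ν t} φ_ν(u₀) a_ν(x))_ν` is absolutely summable and its sum is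
the Burgers evolution `u(t,x) = -2 ∂ₓv(t,x)/v(t,x)` of `u₀`. -/
theorem koopman_decomposition_burgers (u₀ : ℝ → ℝ) (h : MemOmegaB u₀) :
    ∀ t : ℝ, 0 < t → ∀ x ∈ Icc (0:ℝ) 1,
      Summable (fun ν : KoopIdx => |Real.exp (lamIdx ν * t) * phiIdx u₀ ν * aIdx ν x|) ∧
      (∑' ν : KoopIdx, Real.exp (lamIdx ν * t) * phiIdx u₀ ν * aIdx ν x) =
        burgersU u₀ t x := by

  intro t ht x _
  obtain ⟨hb, hS, hlt⟩ := kd_coef u₀ h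
  set f : ℕ+ → ℝ := fun m => Real.exp (-((m : ℕ) : ℝ) ^ 2 * π ^ 2 * t) * lCoef (m : ℕ) u₀ *
    (Real.sqrt 2 * ((m : ℕ) : ℝ) * π * Real.sin (((m : ℕ) : ℝ) * π * x)) with hf
  set q : ℕ+ → ℝ := fun n => Real.exp (-((n : ℕ) : ℝ) ^ 2 * π ^ 2 * t) * lCoef (n : ℕ) u₀ *
    (Real.sqrt 2 * Real.cos (((n : ℕ) : ℝ) * π * x)) with hq
  have hterm : ∀ ν : KoopIdx, Real.exp (lamIdx ν * t) * phiIdx u₀ ν * aIdx ν x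
      = (2 * f ν.1) * (ν.2.map (fun n => -q n)).prod := fun ν => kd_term u₀ t x ν.1 ν.2
  have hqle : ∀ n, |-q n| ≤ |Real.sqrt 2 * lCoef (n : ℕ) u₀| := by
    intro n
    have e : -q n = (Real.sqrt 2 * lCoef (n : ℕ) u₀) *
      (-(Real.exp (-((n : ℕ) : ℝ) ^ 2 * π ^ 2 * t) * Real.cos (((n : ℕ) : ℝ) * π * x))) := by
      simp only [hq]; ring
    rw [e, abs_mul]
    refine mul_le_of_le_one_right (abs_nonneg _) ?_
    rw [abs_neg, abs_mul, Real.abs_exp]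
    refine mul_le_one₀ (Real.exp_le_one_iff.2 ?_) (abs_nonneg _) (Real.abs_cos_le_one _)
    have : 0 ≤ ((n : ℕ) : ℝ) ^ 2 * π ^ 2 * t := by positivity
    linarith
  have hqS : Summable (fun n => |-q n|) :=
    Summable.of_nonneg_of_le (fun _ => abs_nonneg _) hqle hS
  have hqlt : ∑' n, |-q n| < 1 := lt_of_le_of_lt (hqS.tsum_le_tsum hqle hS) hlt
  have hfS : Summable (fun m => |2 * f m|) := by
    have hgeo : Summable (fun m : ℕ+ => 2 * Real.exp (-(π ^ 2 * t)) ^ (m : ℕ)) := by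
      apply Summable.mul_left
      exact (summable_geometric_of_lt_one (Real.exp_pos _).le
        (Real.exp_lt_one_iff.2 (neg_lt_zero.2 (by positivity)))).comp_injective
        PNat.coe_injective
    refine Summable.of_nonneg_of_le (fun _ => abs_nonneg _) (fun m => ?_) hgeo
    have e : f m = Real.exp (-((m : ℕ) : ℝ) ^ 2 * π ^ 2 * t) *
      ((Real.sqrt 2 * lCoef (m : ℕ) u₀ * ((m : ℕ) * π)) * Real.sin (((m : ℕ) : ℝ) * π * x)) := by
      simp only [hf]; ring
    rw [abs_mul, abs_two, e, abs_mul, Real.abs_exp, abs_mul]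
    have h1 : |Real.sqrt 2 * lCoef (m : ℕ) u₀ * ((m : ℕ) * π)| *
      |Real.sin (((m : ℕ) : ℝ) * π * x)| ≤ 1 :=
      mul_le_one₀ (hb m) (abs_nonneg _) (Real.abs_sin_le_one _)
    have h2 : Real.exp (-((m : ℕ) : ℝ) ^ 2 * π ^ 2 * t) ≤ Real.exp (-(π ^ 2 * t)) ^ (m : ℕ) := by
      rw [← Real.exp_nat_mul]
      apply Real.exp_le_exp.2
      have hm : (1:ℝ) ≤ (m : ℕ) := by exact_mod_cast m.pos
      have h3 : ((m : ℕ) : ℝ) ≤ ((m : ℕ) : ℝ) ^ 2 := by nlinarith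
      have h4 : 0 ≤ π ^ 2 * t := by positivity
      nlinarith [mul_le_mul_of_nonneg_right h3 h4]
    have h5 := mul_le_of_le_one_right (Real.exp_pos (-((m : ℕ) : ℝ) ^ 2 * π ^ 2 * t)).le h1
    linarith
  have hLS := kd_list_summable (fun n => -q n) hqS hqlt
  have hLT := kd_list_tsum (fun n => -q n) hqS hqlt
  simp_rw [hterm]
  refine ⟨?_, ?_⟩
  · have := hfS.mul_of_nonneg hLS (fun _ => abs_nonneg _) (fun _ => abs_nonneg _)
    simpa only [abs_mul] using this
  · have hfn : Summable (fun m => ‖2 * f m‖) := by simpa only [Real.norm_eq_abs] using hfS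
    have hLn : Summable (fun l : List ℕ+ => ‖(l.map (fun n => -q n)).prod‖) := by
      simpa only [Real.norm_eq_abs] using hLS
    have h1 := tsum_mul_tsum_of_summable_norm hfn hLn
    rw [← h1, hLT, tsum_mul_left, tsum_neg]
    have e1 : heatVx u₀ t x = -∑' m, f m := rfl
    have e2 : heatV u₀ t x = 1 + ∑' n, q n := rfl
    rw [burgersU, e1, e2]
    ring
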